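/- Let N ≥ 1, let k₁, …, k_N ∈ ℂ satisfy k_i + conj(k_j) ≠ 0 for all i, j, and fix phase constants λ₁ᵢ, λ₂ᵢ ∈ ℂ. For (x, t) ∈ ℝ² define the plane wave factors ρ₁ᵢ(x,t) = exp(x/(2k_i) + k_i t/2 + λ₁ᵢ) and ρ₂ᵢ(x,t) = exp(−x/(2k_i) − k_i t/2 + λ₂ᵢ), the column vectors r₁ = (ρ₁₁, …, ρ₁ᴺ)ᵀ, r₂ = (ρ₂₁, …, ρ₂ᴺ)ᵀ, and the N×N matrix M(x,t) with entries M_{ij} = (ρ₂ᵢ·conj(ρ₂ⱼ) − i·ρ₁ᵢ·conj(ρ₁ⱼ)·conj(k_j)) / (k_i + conj(k_j)). Assume k_i ≠ 0 for all i and that M(x,t) is invertible for every (x, t). Then u(x,t) = r₂(x,t)†·M(x,t)⁻¹·r₁(x,t) solves the Fokas–Lenells equation u_{xt} − u − 2i·|u|²·u_x = 0. -/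

import Mathlib

open Matrix

/-- Partial derivative with respect to the first coordinate `x`. -/
noncomputable def pdx (f : ℝ × ℝ → ℂ) (p : ℝ × ℝ) : ℂ :=
  deriv (fun s => f (s, p.2)) p.1

/-- Partial derivative with respect to the second coordinate `t`. -/
noncomputable def pdt (f : ℝ × ℝ → ℂ) (p : ℝ × ℝ) : ℂ :=
  deriv (fun s => f (p.1, s)) p.2

theorem Matrix.hasDerivAt_inv {n : Type*} [Fintype n] [DecidableEq n] {A : ℝ → Matrix n n ℂ}
    {A' : Matrix n n ℂ} {s : ℝ} (hA : ∀ i j, HasDerivAt (fun x => A x i j) (A' i j) s)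
    (hu : IsUnit (A s)) (i j : n) :
    HasDerivAt (fun x => (A x)⁻¹ i j) ((-((A s)⁻¹ * A' * (A s)⁻¹)) i j) s := by
  let : NormedRing (Matrix n n ℂ) := Matrix.linftyOpNormedRing
  let : NormedAlgebra ℝ (Matrix n n ℂ) := Matrix.linftyOpNormedAlgebra
  have h1 : HasDerivAt A A' s :=
    hasDerivAt_pi.2 fun i => hasDerivAt_pi.2 fun j => hA i j
  obtain ⟨U, hU⟩ := hu
  have h2 := hasFDerivAt_ringInverse (𝕜 := ℝ) U
  rw [hU] at h2
  have h3 := hasDerivAt_pi.1 (hasDerivAt_pi.1 (h2.comp_hasDerivAt s h1) i) j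
  have hUi : (↑U⁻¹ : Matrix n n ℂ) = (A s)⁻¹ := by
    rw [← hU, Matrix.coe_units_inv]
  simpa [Function.comp_def, Matrix.nonsing_inv_eq_ringInverse, hUi] using h3

/-- The bilinear form `wᵀ A⁻¹ v` attached to the inverse of a matrix. -/
noncomputable def invForm {n : Type*} [Fintype n] [DecidableEq n] (A : Matrix n n ℂ)
    (w v : n → ℂ) : ℂ :=
  w ⬝ᵥ (A⁻¹ *ᵥ v)

section InvForm

variable {n : Type*} [Fintype n] [DecidableEq n]

theorem hasDerivAt_invForm {A : ℝ → Matrix n n ℂ} {A' : Matrix n n ℂ} {w v : ℝ → n → ℂ}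
    {w' v' : n → ℂ} {s : ℝ} (hA : ∀ i j, HasDerivAt (fun x => A x i j) (A' i j) s)
    (hu : IsUnit (A s)) (hw : ∀ i, HasDerivAt (fun x => w x i) (w' i) s)
    (hv : ∀ i, HasDerivAt (fun x => v x i) (v' i) s) :
    HasDerivAt (fun x => invForm (A x) (w x) (v x))
      (invForm (A s) w' (v s) + invForm (A s) (w s) v'
        - w s ⬝ᵥ (((A s)⁻¹ * A' * (A s)⁻¹) *ᵥ v s)) s := by
  have h := HasDerivAt.fun_sum (u := Finset.univ) fun i _ => (hw i).mul
    (HasDerivAt.fun_sum (u := Finset.univ) fun j _ =>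
      (Matrix.hasDerivAt_inv hA hu i j).mul (hv j))
  refine h.congr_deriv ?_
  simp only [invForm, dotProduct, mulVec, Matrix.neg_apply, ← Finset.sum_add_distrib,
    ← Finset.sum_sub_distrib]
  refine Finset.sum_congr rfl fun i _ => ?_
  simp only [Pi.mul_apply, neg_mul, Finset.sum_add_distrib, Finset.sum_neg_distrib]
  ring

theorem dotProduct_inv_mul_vecMulVec_mul_inv_mulVec (A : Matrix n n ℂ) (w v p q : n → ℂ) :
    w ⬝ᵥ ((A⁻¹ * vecMulVec p q * A⁻¹) *ᵥ v) = invForm A w p * invForm A q v := by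
  rw [← mulVec_mulVec, ← mulVec_mulVec, vecMulVec_mulVec]
  simp [invForm, mulVec_smul, mul_comm]

/-- A matrix solving a Sylvester equation with diagonal coefficients and right-hand side of rank
two satisfies the corresponding bilinear identities for its inverse. -/
theorem invForm_sylvester {A : Matrix n n ℂ} (hA : IsUnit A) {d e p q p' q' : n → ℂ}
    (h : diagonal d * A + A * diagonal e = vecMulVec p q - Complex.I • vecMulVec p' q')
    (w v : n → ℂ) :
    invForm A (e * w) v + invForm A w (d * v) =
      invForm A w p * invForm A q v - Complex.I * (invForm A w p' * invForm A q' v) := by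
  have hd : IsUnit A.det := (Matrix.isUnit_iff_isUnit_det A).1 hA
  have h1 : A⁻¹ * diagonal d + diagonal e * A⁻¹ =
      A⁻¹ * vecMulVec p q * A⁻¹ - Complex.I • (A⁻¹ * vecMulVec p' q' * A⁻¹) := by
    have h2 := congrArg (fun X => A⁻¹ * X * A⁻¹) h
    simp only [mul_add, add_mul, mul_sub, sub_mul, mul_smul_comm, smul_mul_assoc] at h2
    rw [← h2, ← mul_assoc, ← mul_assoc, mul_assoc (A⁻¹ * diagonal d), mul_nonsing_inv _ hd,
      nonsing_inv_mul _ hd, mul_one, one_mul]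
  have h3 := congrArg (fun X => w ⬝ᵥ (X *ᵥ v)) h1
  simp only [add_mulVec, sub_mulVec, smul_mulVec, dotProduct_add, dotProduct_sub,
    dotProduct_smul, dotProduct_inv_mul_vecMulVec_mul_inv_mulVec, smul_eq_mul] at h3
  rw [← h3, add_comm]
  simp only [invForm, ← mulVec_mulVec]
  have hdv : diagonal d *ᵥ v = d * v := by ext i; simp [mulVec_diagonal]
  rw [hdv]
  congr 1
  simp only [dotProduct, mulVec_diagonal, Pi.mul_apply]
  refine Finset.sum_congr rfl fun i _ => ?_
  ring

/-- Derivative of an inverse form along a flow generated by a Sylvester equation; the constant `α`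
is the growth rate of `w` relative to that of `v`. -/
theorem hasDerivAt_invForm_of_sylvester {A : ℝ → Matrix n n ℂ} {d e p q p' q' : n → ℂ}
    {w v : ℝ → n → ℂ} {s : ℝ} (α : ℂ) (hu : IsUnit (A s))
    (h : diagonal d * A s + A s * diagonal e = vecMulVec p q - Complex.I • vecMulVec p' q')
    (hA : ∀ i j, HasDerivAt (fun x => A x i j)
      ((-(p i * q j) - Complex.I * (p' i * q' j)) / 2) s)
    (hw : ∀ i, HasDerivAt (fun x => w x i) (α * (e i * w s i) / 2) s)
    (hv : ∀ i, HasDerivAt (fun x => v x i) (d i * v s i / 2) s) :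
    HasDerivAt (fun x => invForm (A x) (w x) (v x))
      ((α + 1) / 2 * (invForm (A s) (w s) p * invForm (A s) q (v s))
        + (1 - α) / 2 * (invForm (A s) (w s) (d * v s)
          + Complex.I * (invForm (A s) (w s) p' * invForm (A s) q' (v s)))) s := by
  have hA' : ∀ i j, HasDerivAt (fun x => A x i j)
      ((-(1 / 2 : ℂ) • vecMulVec p q - (Complex.I / 2) • vecMulVec p' q') i j) s := fun i j =>
    (hA i j).congr_deriv (by simp [vecMulVec_apply]; ring)
  have hw' : ∀ i, HasDerivAt (fun x => w x i) (((α / 2) • (e * w s)) i) s := fun i =>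
    (hw i).congr_deriv (by simp; ring)
  have hv' : ∀ i, HasDerivAt (fun x => v x i) (((1 / 2 : ℂ) • (d * v s)) i) s := fun i =>
    (hv i).congr_deriv (by simp; ring)
  refine (hasDerivAt_invForm hA' hu hw' hv').congr_deriv ?_
  have hs := invForm_sylvester hu h (w s) (v s)
  simp only [mul_sub, sub_mul, mul_smul_comm, smul_mul_assoc, sub_mulVec, smul_mulVec,
    dotProduct_sub, dotProduct_smul, dotProduct_inv_mul_vecMulVec_mul_inv_mulVec, smul_eq_mul]
  have e1 : invForm (A s) ((α / 2) • (e * w s)) (v s) =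
      α / 2 * invForm (A s) (e * w s) (v s) := by simp [invForm]
  have e2 : invForm (A s) (w s) ((1 / 2 : ℂ) • (d * v s)) =
      1 / 2 * invForm (A s) (w s) (d * v s) := by simp [invForm, mulVec_smul]
  rw [e1, e2]
  linear_combination α / 2 * hs

/-- If `Aᴴ` is a rank one perturbation of `A`, then so is the conjugate of the inverse form. -/
theorem star_invForm_of_conjTranspose_eq {A : Matrix n n ℂ} (hA : IsUnit A) {r₁ r₂ : n → ℂ}
    (h : Aᴴ = A + Complex.I • vecMulVec r₁ (star r₁)) :
    (1 + Complex.I * invForm A (star r₁) r₁) * star (invForm A (star r₂) r₁) =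
      invForm A (star r₁) r₂ := by
  have hd : IsUnit A.det := (Matrix.isUnit_iff_isUnit_det A).1 hA
  have hd' : IsUnit Aᴴ.det := by
    rw [det_conjTranspose]; exact hd.star
  have hc : star (invForm A (star r₂) r₁) = star r₁ ⬝ᵥ ((Aᴴ)⁻¹ *ᵥ r₂) := by
    rw [invForm, ← star_dotProduct_star, star_mulVec, star_star, ← dotProduct_mulVec,
      conjTranspose_nonsing_inv]
  set y := (Aᴴ)⁻¹ *ᵥ r₂ with hy
  have h1 : Aᴴ *ᵥ y = r₂ := by
    rw [hy, mulVec_mulVec, mul_nonsing_inv _ hd', one_mulVec]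
  rw [h, add_mulVec, smul_mulVec, vecMulVec_mulVec] at h1
  have h2 := congrArg (fun z => star r₁ ⬝ᵥ (A⁻¹ *ᵥ z)) h1
  simp only [mulVec_add, mulVec_mulVec, nonsing_inv_mul _ hd, one_mulVec, mulVec_smul,
    dotProduct_add, dotProduct_smul] at h2
  rw [hc, invForm, invForm, ← h2]
  simp
  ring

end InvForm

/-- the KP-type Cauchy matrix `N`-soliton formula
`u = r₂†·M⁻¹·r₁` solves the Fokas–Lenells equation `u_{xt} − u − 2i·|u|²·u_x = 0`. -/
theorem FL_Nsoliton_KP (N : ℕ) (hN : 1 ≤ N)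
    (k : Fin N → ℂ) (hk0 : ∀ i, k i ≠ 0)
    (hk : ∀ i j, k i + starRingEnd ℂ (k j) ≠ 0)
    (lam1 lam2 : Fin N → ℂ)
    (ρ1 ρ2 : Fin N → ℝ × ℝ → ℂ)
    (hρ1 : ρ1 = fun i p =>
      Complex.exp ((p.1 : ℂ) / (2 * k i) + k i * (p.2 : ℂ) / 2 + lam1 i))
    (hρ2 : ρ2 = fun i p =>
      Complex.exp (-((p.1 : ℂ) / (2 * k i)) - k i * (p.2 : ℂ) / 2 + lam2 i))
    (M : ℝ × ℝ → Matrix (Fin N) (Fin N) ℂ)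
    (hM : M = fun p => Matrix.of fun i j =>
      (ρ2 i p * starRingEnd ℂ (ρ2 j p)
        - Complex.I * ρ1 i p * starRingEnd ℂ (ρ1 j p) * starRingEnd ℂ (k j)) /
        (k i + starRingEnd ℂ (k j)))
    (hMinv : ∀ p, IsUnit (M p))
    (u : ℝ × ℝ → ℂ)
    (hu : u = fun p => (fun i => starRingEnd ℂ (ρ2 i p)) ⬝ᵥ ((M p)⁻¹ *ᵥ fun i => ρ1 i p)) :
    ∀ p, pdt (pdx u) p - u p
      - 2 * Complex.I * (u p * starRingEnd ℂ (u p)) * pdx u p = 0 := by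
  subst hu
  set r1 : ℝ × ℝ → Fin N → ℂ := fun p i => ρ1 i p with hr1
  set r2 : ℝ × ℝ → Fin N → ℂ := fun p i => ρ2 i p with hr2
  have hk' : ∀ i, starRingEnd ℂ (k i) ≠ 0 := fun i => by simpa using hk0 i
  have hS : ∀ p, diagonal k * M p + M p * diagonal (star k) =
      vecMulVec (r2 p) (star (r2 p)) - Complex.I • vecMulVec (r1 p) (star k * star (r1 p)) := by
    intro p
    ext i j
    have := hk i j
    simp [hM, hr1, hr2, vecMulVec_apply]
    field_simp
  have hS' : ∀ p, diagonal k⁻¹ * M p + M p * diagonal (star k)⁻¹ =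
      vecMulVec (k⁻¹ * r2 p) ((star k)⁻¹ * star (r2 p))
        - Complex.I • vecMulVec (k⁻¹ * r1 p) (star (r1 p)) := by
    intro p
    ext i j
    have := hk i j
    have := hk0 i
    have := hk' j
    simp [hM, hr1, hr2, vecMulVec_apply]
    field_simp
    ring
  have hH : ∀ p, (M p)ᴴ = M p + Complex.I • vecMulVec (r1 p) (star (r1 p)) := by
    intro p
    ext i j
    have := hk i j
    have : starRingEnd ℂ (k j) + k i ≠ 0 := by rw [add_comm]; exact hk i j
    simp [hM, hr1, vecMulVec_apply]
    field_simp
    ring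
  have h1x : ∀ (p : ℝ × ℝ) i,
      HasDerivAt (fun s : ℝ => ρ1 i (s, p.2)) ((k i)⁻¹ * ρ1 i p / 2) p.1 := by
    intro p i
    have h := ((((hasDerivAt_id (p.1 : ℂ)).div_const (2 * k i)).add_const
      (k i * (p.2 : ℂ) / 2)).add_const (lam1 i)).cexp.comp_ofReal
    rw [hρ1]
    refine h.congr_deriv ?_
    simp only [id]
    field_simp
  have h1t : ∀ (p : ℝ × ℝ) i,
      HasDerivAt (fun s : ℝ => ρ1 i (p.1, s)) (k i * ρ1 i p / 2) p.2 := by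
    intro p i
    have h := (((((hasDerivAt_id (p.2 : ℂ)).const_mul (k i)).div_const 2).const_add
      ((p.1 : ℂ) / (2 * k i))).add_const (lam1 i)).cexp.comp_ofReal
    rw [hρ1]
    refine h.congr_deriv ?_
    simp only [id]
    ring
  have h2x : ∀ (p : ℝ × ℝ) i,
      HasDerivAt (fun s : ℝ => ρ2 i (s, p.2)) (-((k i)⁻¹ * ρ2 i p / 2)) p.1 := by
    intro p i
    have h := ((((hasDerivAt_id (p.1 : ℂ)).div_const (2 * k i)).neg.sub_const
      (k i * (p.2 : ℂ) / 2)).add_const (lam2 i)).cexp.comp_ofReal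
    rw [hρ2]
    refine h.congr_deriv ?_
    simp only [id, Pi.neg_apply]
    field_simp
  have h2t : ∀ (p : ℝ × ℝ) i,
      HasDerivAt (fun s : ℝ => ρ2 i (p.1, s)) (-(k i * ρ2 i p / 2)) p.2 := by
    intro p i
    have h := (((((hasDerivAt_id (p.2 : ℂ)).const_mul (k i)).div_const 2).const_sub
      (-((p.1 : ℂ) / (2 * k i)))).add_const (lam2 i)).cexp.comp_ofReal
    rw [hρ2]
    refine h.congr_deriv ?_
    simp only [id]
    ring
  have hMx : ∀ (p : ℝ × ℝ) i j, HasDerivAt (fun s : ℝ => M (s, p.2) i j)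
      ((-((k⁻¹ * r2 p) i * ((star k)⁻¹ * star (r2 p)) j)
        - Complex.I * ((k⁻¹ * r1 p) i * (star (r1 p)) j)) / 2) p.1 := by
    intro p i j
    have h := ((((h2x p i).mul (h2x p j).star).sub
      ((((h1x p i).const_mul Complex.I).mul (h1x p j).star).mul_const
        (starRingEnd ℂ (k j)))).div_const (k i + starRingEnd ℂ (k j)))
    rw [hM]
    refine h.congr_deriv ?_
    have := hk i j
    have := hk0 i
    have := hk' j
    simp [hr1, hr2]
    field_simp
    ring
  have hMt : ∀ (p : ℝ × ℝ) i j, HasDerivAt (fun s : ℝ => M (p.1, s) i j)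
      ((-((r2 p) i * (star (r2 p)) j)
        - Complex.I * ((r1 p) i * (star k * star (r1 p)) j)) / 2) p.2 := by
    intro p i j
    have h := ((((h2t p i).mul (h2t p j).star).sub
      ((((h1t p i).const_mul Complex.I).mul (h1t p j).star).mul_const
        (starRingEnd ℂ (k j)))).div_const (k i + starRingEnd ℂ (k j)))
    rw [hM]
    refine h.congr_deriv ?_
    have := hk i j
    simp [hr1, hr2]
    field_simp
    ring
  have hux : pdx (fun p => invForm (M p) (star (r2 p)) (r1 p)) = fun p =>
      invForm (M p) (star (r2 p)) (k⁻¹ * r1 p) *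
        (1 + Complex.I * invForm (M p) (star (r1 p)) (r1 p)) := by
    funext p
    have h := hasDerivAt_invForm_of_sylvester (A := fun s => M (s, p.2))
      (w := fun s => star (r2 (s, p.2))) (v := fun s => r1 (s, p.2)) (-1) (hMinv p) (hS' p)
      (hMx p) (fun i => (h2x p i).star.congr_deriv (by simp [hr2]; ring)) (h1x p)
    refine (h.congr_deriv ?_).deriv
    ring
  have hRt : ∀ p : ℝ × ℝ, HasDerivAt
      (fun s => invForm (M (p.1, s)) (star (r2 (p.1, s))) (k⁻¹ * r1 (p.1, s)))
      (invForm (M p) (star (r2 p)) (r1 p) * (1 + Complex.I *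
        invForm (M p) (star k * star (r1 p)) (k⁻¹ * r1 p))) p.2 := by
    intro p
    have h := hasDerivAt_invForm_of_sylvester (A := fun s => M (p.1, s))
      (w := fun s => star (r2 (p.1, s))) (v := fun s => k⁻¹ * r1 (p.1, s)) (-1) (hMinv p) (hS p)
      (hMt p) (fun i => (h2t p i).star.congr_deriv (by simp [hr2]; ring))
      (fun i => ((h1t p i).const_mul (k i)⁻¹).congr_deriv (by simp [hr1]; ring))
    have hkk : k * (k⁻¹ * r1 p) = r1 p := by
      ext i
      simp [hk0 i]
    refine h.congr_deriv ?_
    rw [hkk]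
    ring
  have hct : ∀ p : ℝ × ℝ, HasDerivAt
      (fun s => invForm (M (p.1, s)) (star (r1 (p.1, s))) (r1 (p.1, s)))
      (invForm (M p) (star (r1 p)) (r2 p) * invForm (M p) (star (r2 p)) (r1 p)) p.2 := by
    intro p
    have h := hasDerivAt_invForm_of_sylvester (A := fun s => M (p.1, s))
      (w := fun s => star (r1 (p.1, s))) (v := fun s => r1 (p.1, s)) 1 (hMinv p) (hS p)
      (hMt p) (fun i => (h1t p i).star.congr_deriv (by simp [hr1])) (h1t p)
    refine h.congr_deriv ?_
    ring
  intro p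
  change pdt (pdx fun p => invForm (M p) (star (r2 p)) (r1 p)) p
    - invForm (M p) (star (r2 p)) (r1 p) - 2 * Complex.I *
      (invForm (M p) (star (r2 p)) (r1 p) * star (invForm (M p) (star (r2 p)) (r1 p))) *
      pdx (fun p => invForm (M p) (star (r2 p)) (r1 p)) p = 0
  have hut := ((hRt p).mul (((hct p).const_mul Complex.I).const_add 1)).deriv
  have hconj := star_invForm_of_conjTranspose_eq (hMinv p) (r₂ := r2 p) (hH p)
  have hsyl := invForm_sylvester (hMinv p) (hS p) (star (r1 p)) (k⁻¹ * r1 p)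
  have hkk : k * (k⁻¹ * r1 p) = r1 p := by
    ext i
    simp [hk0 i]
  rw [hkk] at hsyl
  rw [hux, pdt]
  refine (congrArg (fun z => z - _ - _) hut).trans ?_
  simp only [Prod.mk.eta]
  generalize invForm (M p) (star (r2 p)) (r1 p) = u at *
  generalize invForm (M p) (star (r1 p)) (r1 p) = c at *
  generalize invForm (M p) (star (r1 p)) (r2 p) = a at *
  generalize invForm (M p) (star (r2 p)) (k⁻¹ * r1 p) = R at *
  generalize invForm (M p) (star k * star (r1 p)) (k⁻¹ * r1 p) = T at *
  linear_combination (-2 * Complex.I * u * R) * hconj + Complex.I * u * hsyl
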